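/- arXiv:2403.16456 — 4 statements merged into one kernel-verified Lean document; each statement's English description precedes it below -/
import Mathlib

section
/- There exists a family of real 32×32 matrices Γ₀, Γ₁, …, Γ₁₀ such that (i) Γ_a Γ_b + Γ_b Γ_a = 2 η_{ab} · Id for all a, b ∈ {0,…,10}, (ii) the ordered product satisfies Γ₀ Γ₁ ⋯ Γ₁₀ = Id, and (iii) the Majorana symmetry condition Γ_aᵀ = Γ₀ Γ_a Γ₀ holds for all a ∈ {0,…,10}. (This is the Majorana spinor representation 𝟑𝟐 of Spin(1,10), constructed in the paper via octonionic Dirac matrices.) -/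
open Matrix BigOperators

noncomputable section

/-- The 11×11 Minkowski metric `η = diag(−1,+1,…,+1)`. -/
def eta (a b : Fin 11) : ℝ :=
  if a = b then (if a = 0 then -1 else 1) else 0

/-- The nontrivial real character of `ZMod 2`, sending `0` to `1` and `1` to `-1`. -/
def signChar (c : ZMod 2) : ℝ :=
  if c = 0 then 1 else -1

lemma signChar_zero : signChar 0 = 1 := if_pos rfl

lemma signChar_one : signChar 1 = -1 := if_neg one_ne_zero

lemma ZMod.eq_zero_or_eq_one_of_two : ∀ c : ZMod 2, c = 0 ∨ c = 1 := by
  decide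

lemma signChar_add (c d : ZMod 2) : signChar (c + d) = signChar c * signChar d := by
  obtain rfl | rfl := ZMod.eq_zero_or_eq_one_of_two c <;>
    obtain rfl | rfl := ZMod.eq_zero_or_eq_one_of_two d <;>
    simp [signChar_zero, signChar_one, CharTwo.add_self_eq_zero]

lemma signChar_add_signChar_of_ne {c d : ZMod 2} (h : c ≠ d) :
    signChar c + signChar d = 0 := by
  obtain rfl | rfl := ZMod.eq_zero_or_eq_one_of_two c <;>
    obtain rfl | rfl := ZMod.eq_zero_or_eq_one_of_two d <;>
    simp_all [signChar_zero, signChar_one]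

section Weyl

variable {ι : Type*} [Fintype ι]

/-- The real Pauli operator `X^x Z^z` on functions on `𝔽₂^ι`, where `p = (x, z)`. -/
def weyl (p : (ι → ZMod 2) × (ι → ZMod 2)) : Matrix (ι → ZMod 2) (ι → ZMod 2) ℝ :=
  Matrix.of fun i j => if i = j + p.1 then signChar (p.2 ⬝ᵥ j) else 0

lemma weyl_apply (p : (ι → ZMod 2) × (ι → ZMod 2)) (i j : ι → ZMod 2) :
    weyl p i j = if i = j + p.1 then signChar (p.2 ⬝ᵥ j) else 0 := rfl

lemma weyl_zero [DecidableEq ι] : weyl (0 : (ι → ZMod 2) × (ι → ZMod 2)) = 1 := by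
  ext i j
  simp [weyl_apply, Matrix.one_apply, signChar_zero]

lemma weyl_mul [DecidableEq ι] (p q : (ι → ZMod 2) × (ι → ZMod 2)) :
    weyl p * weyl q = signChar (p.2 ⬝ᵥ q.1) • weyl (p + q) := by
  ext i k
  rw [Matrix.mul_apply, Finset.sum_eq_single (k + q.1)]
  · simp only [weyl_apply, Matrix.smul_apply, Prod.fst_add, Prod.snd_add, if_true,
      dotProduct_add, add_dotProduct, signChar_add, smul_eq_mul,
      show k + q.1 + p.1 = k + (p.1 + q.1) by abel]
    split_ifs <;> ring
  · intro j _ hj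
    simp [weyl_apply q, hj]
  · simp

lemma weyl_transpose (p : (ι → ZMod 2) × (ι → ZMod 2)) :
    (weyl p)ᵀ = signChar (p.2 ⬝ᵥ p.1) • weyl p := by
  ext i j
  have hshift : j = i + p.1 ↔ i = j + p.1 := by
    have hp : p.1 + p.1 = 0 := funext fun k => CharTwo.add_self_eq_zero (p.1 k)
    constructor <;> rintro rfl <;> simp [add_assoc, hp]
  simp only [Matrix.transpose_apply, Matrix.smul_apply, weyl_apply, hshift, smul_eq_mul]
  split_ifs with h
  · rw [h, dotProduct_add, signChar_add, mul_comm]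
  · simp

/-- The exponent of the sign produced by multiplying out a list of real Pauli operators. -/
def weylPhase : List ((ι → ZMod 2) × (ι → ZMod 2)) → ZMod 2
  | [] => 0
  | p :: l => weylPhase l + p.2 ⬝ᵥ l.sum.1

lemma prod_map_weyl [DecidableEq ι] (l : List ((ι → ZMod 2) × (ι → ZMod 2))) :
    (l.map weyl).prod = signChar (weylPhase l) • weyl l.sum := by
  induction l with
  | nil => simp [weylPhase, signChar_zero, weyl_zero]
  | cons p l ih =>
    simp [weylPhase, ih, weyl_mul, signChar_add, smul_smul]

lemma weyl_mul_self [DecidableEq ι] (p : (ι → ZMod 2) × (ι → ZMod 2)) :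
    weyl p * weyl p = signChar (p.2 ⬝ᵥ p.1) • 1 := by
  have hp : p + p = 0 := by ext <;> simp [CharTwo.add_self_eq_zero]
  rw [weyl_mul, hp, weyl_zero]

lemma weyl_anticommute [DecidableEq ι] {p q : (ι → ZMod 2) × (ι → ZMod 2)}
    (h : p.2 ⬝ᵥ q.1 ≠ q.2 ⬝ᵥ p.1) : weyl p * weyl q + weyl q * weyl p = 0 := by
  rw [weyl_mul, weyl_mul, add_comm q p, ← add_smul, signChar_add_signChar_of_ne h, zero_smul]

end Weyl

/-- Exponents `(x, z)` of eleven pairwise anticommuting real Pauli operators on five qubits,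
of which the first is antisymmetric and the others are symmetric. -/
def majoranaExponent : Fin 11 → (Fin 5 → ZMod 2) × (Fin 5 → ZMod 2) :=
  ![(![1, 0, 0, 0, 0], ![1, 0, 0, 0, 0]),
    (![0, 0, 0, 0, 0], ![1, 0, 0, 0, 0]),
    (![1, 0, 0, 0, 0], ![0, 1, 0, 0, 0]),
    (![1, 1, 0, 0, 0], ![0, 0, 0, 0, 0]),
    (![1, 1, 1, 0, 0], ![0, 1, 1, 0, 0]),
    (![1, 1, 0, 1, 0], ![0, 1, 1, 1, 0]),
    (![1, 1, 1, 1, 0], ![0, 1, 0, 1, 1]),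
    (![1, 1, 0, 0, 1], ![0, 1, 1, 1, 1]),
    (![1, 1, 1, 0, 1], ![0, 1, 0, 0, 1]),
    (![1, 1, 1, 1, 1], ![0, 1, 0, 1, 0]),
    (![1, 1, 0, 1, 1], ![0, 1, 1, 0, 1])]

lemma majoranaExponent_symplectic {a b : Fin 11} (h : a ≠ b) :
    (majoranaExponent a).2 ⬝ᵥ (majoranaExponent b).1
      ≠ (majoranaExponent b).2 ⬝ᵥ (majoranaExponent a).1 := by
  revert a b
  decide

lemma majoranaExponent_self (a : Fin 11) :
    (majoranaExponent a).2 ⬝ᵥ (majoranaExponent a).1 = if a = 0 then 1 else 0 := by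
  revert a
  decide

lemma sum_majoranaExponent : (List.ofFn majoranaExponent).sum = 0 := by
  decide

lemma weylPhase_majoranaExponent : weylPhase (List.ofFn majoranaExponent) = 0 := by
  decide

lemma signChar_majoranaExponent_self (a : Fin 11) :
    signChar ((majoranaExponent a).2 ⬝ᵥ (majoranaExponent a).1) = eta a a := by
  rw [majoranaExponent_self]
  by_cases ha : a = 0 <;> simp [ha, eta, signChar_zero, signChar_one]

lemma weyl_majoranaExponent_clifford (a b : Fin 11) :
    weyl (majoranaExponent a) * weyl (majoranaExponent b)
      + weyl (majoranaExponent b) * weyl (majoranaExponent a) = (2 * eta a b) • 1 := by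
  by_cases h : a = b
  · subst h
    rw [weyl_mul_self, signChar_majoranaExponent_self, ← add_smul, two_mul]
  · rw [weyl_anticommute (majoranaExponent_symplectic h)]
    simp [eta, h]

lemma weyl_majoranaExponent_prod :
    (List.ofFn fun a => weyl (majoranaExponent a)).prod = 1 := by
  have := prod_map_weyl (List.ofFn majoranaExponent)
  rwa [weylPhase_majoranaExponent, sum_majoranaExponent, weyl_zero, signChar_zero, one_smul,
    List.map_ofFn] at this

lemma weyl_majoranaExponent_transpose (a : Fin 11) :
    (weyl (majoranaExponent a))ᵀ
      = weyl (majoranaExponent 0) * weyl (majoranaExponent a) * weyl (majoranaExponent 0) := by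
  have hsq : weyl (majoranaExponent 0) * weyl (majoranaExponent 0) = -1 := by
    rw [weyl_mul_self, signChar_majoranaExponent_self]
    simp [eta]
  rw [weyl_transpose, signChar_majoranaExponent_self]
  by_cases ha : a = 0
  · subst ha
    simp [hsq, eta]
  · have hanti := eq_neg_of_add_eq_zero_left
      (weyl_anticommute (majoranaExponent_symplectic (Ne.symm ha)))
    rw [hanti, neg_mul, mul_assoc, hsq]
    simp [eta, ha]

/-- There exists a family of real 32×32 matrices `Γ₀, …, Γ₁₀` satisfying
(i) the 11d Clifford relations `Γ_a Γ_b + Γ_b Γ_a = 2 η_{ab} · Id`,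
(ii) the volume normalization `Γ₀ Γ₁ ⋯ Γ₁₀ = Id`, and
(iii) the Majorana symmetry condition `Γ_aᵀ = Γ₀ Γ_a Γ₀`. -/
theorem exists_majorana_representation :
    ∃ Γ : Fin 11 → Matrix (Fin 32) (Fin 32) ℝ,
      (∀ a b : Fin 11, Γ a * Γ b + Γ b * Γ a
          = (2 * eta a b) • (1 : Matrix (Fin 32) (Fin 32) ℝ)) ∧
      (List.ofFn Γ).prod = 1 ∧
      (∀ a : Fin 11, (Γ a)ᵀ = Γ 0 * Γ a * Γ 0) := by
  obtain ⟨e⟩ : Nonempty ((Fin 5 → ZMod 2) ≃ Fin 32) :=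
    ⟨Fintype.equivFinOfCardEq (by simp [ZMod.card])⟩
  let φ := Matrix.reindexAlgEquiv ℝ ℝ e
  refine ⟨fun a => φ (weyl (majoranaExponent a)), fun a b => ?_, ?_, fun a => ?_⟩
  · rw [← map_mul, ← map_mul, ← map_add, weyl_majoranaExponent_clifford, map_smul, map_one]
  · have h := congrArg φ weyl_majoranaExponent_prod
    rwa [map_list_prod, map_one, List.map_ofFn] at h
  · rw [← map_mul, ← map_mul, ← weyl_majoranaExponent_transpose]
    rfl

end
end

section
/- Let A be an associative unital ℝ-algebra and let (Γ_a)_{a=0}^{10} satisfy the 11d Clifford relations together with the volume normalization Γ₀ Γ₁ ⋯ Γ₁₀ = 1. Then for every tuple (a₁,…,a₁₁) of indices in {0,…,10} one has Γ_{a₁⋯a₁₁} = ε_{a₁⋯a₁₁} · 1. -/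
open Matrix BigOperators

noncomputable section

/-- The 11d Clifford relations `Γ_a Γ_b + Γ_b Γ_a = 2 η_{ab} · 1`. -/
def CliffordRel {A : Type*} [Ring A] [Algebra ℝ A] (Γ : Fin 11 → A) : Prop :=
  ∀ a b : Fin 11, Γ a * Γ b + Γ b * Γ a = (2 * eta a b) • (1 : A)

/-- The antisymmetrized Clifford element
`Γ_{a₁⋯a_p} = (1/p!) Σ_{σ ∈ S_p} sgn(σ) Γ_{a_{σ(1)}} ⋯ Γ_{a_{σ(p)}}`. -/
def gammaA {A : Type*} [Ring A] [Algebra ℝ A] (Γ : Fin 11 → A) (p : ℕ)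
    (a : Fin p → Fin 11) : A :=
  (p.factorial : ℝ)⁻¹ • ∑ σ : Equiv.Perm (Fin p),
    ((Equiv.Perm.sign σ : ℤ) : ℝ) • (List.ofFn fun i => Γ (a (σ i))).prod

/-- The Levi-Civita symbol (lower indices): the sign of `(a₁,…,a₁₁)` as a permutation
of `(0,…,10)`, and `0` if two indices coincide; in particular `ε_{0 1 ⋯ 10} = +1`. -/
def epsL (a : Fin 11 → Fin 11) : ℝ :=
  ∑ σ : Equiv.Perm (Fin 11),
    if (∀ i, a i = σ i) then ((Equiv.Perm.sign σ : ℤ) : ℝ) else 0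

/-- Exchanging two adjacent factors of an ordered product of pairwise anticommuting elements
changes its sign. -/
theorem prod_ofFn_swap_castSucc_succ {A : Type*} [Ring A] {n : ℕ} (f : Fin (n + 1) → A)
    (hf : ∀ i j, i ≠ j → f i * f j = -(f j * f i)) (i : Fin n) :
    (List.ofFn fun k => f (Equiv.swap i.castSucc i.succ k)).prod = -(List.ofFn f).prod := by
  induction n with
  | zero => exact i.elim0
  | succ n ih =>
    cases i using Fin.cases with
    | zero =>
      have h : ∀ k : Fin n, Equiv.swap (0 : Fin (n + 2)) 1 k.succ.succ = k.succ.succ := fun k =>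
        Equiv.swap_apply_of_ne_of_ne (Fin.succ_ne_zero _)
          (fun h => Fin.succ_ne_zero k (Fin.succ_injective _ h))
      simp only [List.ofFn_succ, List.prod_cons, Fin.castSucc_zero, Fin.succ_zero_eq_one,
        Equiv.swap_apply_left, Equiv.swap_apply_right, h]
      rw [← mul_assoc, ← mul_assoc, hf 1 0 (by simp), neg_mul]
    | succ i =>
      have h : ∀ k : Fin (n + 1), Equiv.swap i.succ.castSucc i.succ.succ k.succ =
          (Equiv.swap i.castSucc i.succ k).succ := fun k => by
        rw [← Fin.succ_castSucc, (Fin.succ_injective _).map_swap]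
      have h0 : Equiv.swap i.succ.castSucc i.succ.succ 0 = 0 :=
        Equiv.swap_apply_of_ne_of_ne (by simp [Fin.ext_iff])
          (Fin.succ_ne_zero _).symm
      rw [List.ofFn_succ, List.ofFn_succ (f := f), List.prod_cons, List.prod_cons, h0]
      simp only [h]
      rw [ih (fun k => f k.succ) (fun a b hab => hf _ _ (by simpa using hab)), mul_neg]

/-- Permuting the factors of an ordered product of pairwise anticommuting elements multiplies it
by the sign of the permutation. -/
theorem prod_ofFn_perm {A : Type*} [Ring A] {n : ℕ} (σ : Equiv.Perm (Fin (n + 1)))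
    (f : Fin (n + 1) → A) (hf : ∀ i j, i ≠ j → f i * f j = -(f j * f i)) :
    (List.ofFn fun k => f (σ k)).prod = (Equiv.Perm.sign σ : ℤ) • (List.ofFn f).prod := by
  have hσ : σ ∈ Submonoid.closure
      (Set.range fun i : Fin n => Equiv.swap i.castSucc i.succ) := by
    rw [Equiv.Perm.mclosure_swap_castSucc_succ]; trivial
  induction hσ using Submonoid.closure_induction generalizing f with
  | mem x hx =>
    obtain ⟨i, rfl⟩ := hx
    rw [prod_ofFn_swap_castSucc_succ f hf i, Equiv.Perm.sign_swap i.castSucc_lt_succ.ne,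
      Units.val_neg, Units.val_one, neg_one_zsmul]
  | one => simp
  | mul x y _ _ ihx ihy =>
    have h := ihy (fun k => f (x k)) fun i j hij => hf _ _ (x.injective.ne hij)
    simp only [Equiv.Perm.mul_apply]
    rw [h, ihx f hf, smul_smul, Equiv.Perm.sign_mul, Units.val_mul, mul_comm]

theorem CliffordRel.anticomm {A : Type*} [Ring A] [Algebra ℝ A] {Γ : Fin 11 → A}
    (hC : CliffordRel Γ) (i j : Fin 11) (hij : i ≠ j) : Γ i * Γ j = -(Γ j * Γ i) :=
  eq_neg_of_add_eq_zero_left (by simp [hC i j, eta, hij])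

/-- The antisymmetrized element vanishes on tuples with a repeated index. -/
theorem gammaA_eq_zero_of_not_injective {A : Type*} [Ring A] [Algebra ℝ A] (Γ : Fin 11 → A)
    {p : ℕ} {a : Fin p → Fin 11} (ha : ¬ Function.Injective a) : gammaA Γ p a = 0 := by
  obtain ⟨i, j, hij, hne⟩ := Function.not_injective_iff.mp ha
  have hswap : ∀ k, a (Equiv.swap i j k) = a k := fun k => by
    rw [Equiv.swap_apply_def]; split_ifs <;> simp_all
  rw [gammaA, Finset.sum_involution (fun σ _ => Equiv.swap i j * σ), smul_zero]
  · intro σ _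
    simp [hswap, Equiv.Perm.sign_swap hne]
  · intro σ _ _ h
    exact hne (Equiv.swap_eq_one_iff.mp (mul_eq_right.mp h))
  · simp
  · intro σ _
    simp

theorem epsL_eq_zero_of_not_injective {a : Fin 11 → Fin 11} (ha : ¬ Function.Injective a) :
    epsL a = 0 :=
  Finset.sum_eq_zero fun σ _ => if_neg fun h => ha (by rw [funext h]; exact σ.injective)

theorem epsL_perm (π : Equiv.Perm (Fin 11)) : epsL π = ((Equiv.Perm.sign π : ℤ) : ℝ) := by
  simp [epsL, ← Equiv.ext_iff]

/-- For Clifford generators with volume normalization `Γ₀ Γ₁ ⋯ Γ₁₀ = 1`, one has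
`Γ_{a₁⋯a₁₁} = ε_{a₁⋯a₁₁} · 1` for every tuple of indices. -/
theorem gammaA_eleven_eq_epsL_smul_one {A : Type*} [Ring A] [Algebra ℝ A]
    (Γ : Fin 11 → A) (hC : CliffordRel Γ) (hV : (List.ofFn Γ).prod = 1)
    (a : Fin 11 → Fin 11) :
    gammaA Γ 11 a = epsL a • (1 : A) := by
  by_cases ha : Function.Injective a
  · obtain ⟨π, rfl⟩ : ∃ π : Equiv.Perm (Fin 11), a = π :=
      ⟨Equiv.ofBijective a (Finite.injective_iff_bijective.mp ha), rfl⟩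
    have hterm : ∀ σ : Equiv.Perm (Fin 11), ((Equiv.Perm.sign σ : ℤ) : ℝ) •
        (List.ofFn fun i => Γ (π (σ i))).prod = ((Equiv.Perm.sign π : ℤ) : ℝ) • (1 : A) := by
      intro σ
      have h := prod_ofFn_perm (π * σ) Γ hC.anticomm
      simp only [Equiv.Perm.mul_apply] at h
      rw [h, hV, ← Int.cast_smul_eq_zsmul ℝ, smul_smul, ← Int.cast_mul, ← Units.val_mul,
        Equiv.Perm.sign_mul, mul_left_comm, Int.units_mul_self, mul_one]
    rw [gammaA, epsL_perm, Finset.sum_congr rfl fun σ _ => hterm σ, Finset.sum_const,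
      Finset.card_univ, Fintype.card_perm, Fintype.card_fin, ← Nat.cast_smul_eq_nsmul ℝ,
      inv_smul_smul₀ (Nat.cast_ne_zero.mpr (Nat.factorial_ne_zero _))]
  · rw [gammaA_eq_zero_of_not_injective Γ ha, epsL_eq_zero_of_not_injective ha, zero_smul]

end
end

section
/- Let (Γ_a)_{a=0}^{10} be a Majorana representation. Then for every p with 0 ≤ p ≤ 11, every tuple (a₁,…,a_p) of indices in {0,…,10}, and all ψ, φ ∈ ℝ³²: (ψ̄ Γ_{a₁⋯a_p} φ) = −(−1)^{p(p+1)/2} (φ̄ Γ_{a₁⋯a_p} ψ). In particular (p = 0) the Majorana spinor pairing is skew-symmetric: (ψ̄ φ) = −(φ̄ ψ). -/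
open Matrix BigOperators

noncomputable section

/-- A Majorana representation: real 32×32 matrices satisfying the 11d Clifford relations
`Γ_a Γ_b + Γ_b Γ_a = 2 η_{ab} · Id`, the volume normalization `Γ₀ Γ₁ ⋯ Γ₁₀ = Id`,
and the symmetry condition `Γ_aᵀ = Γ₀ Γ_a Γ₀`. -/
def Majorana (Γ : Fin 11 → Matrix (Fin 32) (Fin 32) ℝ) : Prop :=
  CliffordRel Γ ∧ (List.ofFn Γ).prod = 1 ∧ ∀ a, (Γ a)ᵀ = Γ 0 * Γ a * Γ 0

/-- The Majorana spinor pairing `(ψ̄ M φ) := ψᵀ Γ₀ M φ`; for `M = 1` this is `(ψ̄ φ)`. -/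
def pair (Γ : Fin 11 → Matrix (Fin 32) (Fin 32) ℝ) (M : Matrix (Fin 32) (Fin 32) ℝ)
    (ψ φ : Fin 32 → ℝ) : ℝ :=
  ψ ⬝ᵥ (Γ 0 * M).mulVec φ
theorem Equiv.Perm.sign_revPerm (n : ℕ) :
    Equiv.Perm.sign (Fin.revPerm : Equiv.Perm (Fin n)) = (-1) ^ (n * (n - 1) / 2) := by
  rw [Equiv.Perm.sign_eq_prod_prod_Iio]
  have h (j : Fin n) : (∏ i ∈ Finset.Iio j,
      if (Fin.revPerm i : Fin n) < Fin.revPerm j then (1 : ℤˣ) else -1) = (-1) ^ (j : ℕ) := by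
    rw [Finset.prod_congr rfl (g := fun _ => (-1 : ℤˣ)), Finset.prod_const, Fin.card_Iio]
    intro i hi
    rw [if_neg]
    simpa using (Finset.mem_Iio.1 hi).le
  rw [Finset.prod_congr rfl fun j _ => h j, Finset.prod_pow_eq_pow_sum,
    Fin.sum_univ_eq_sum_range (fun i => i), Finset.sum_range_id]

theorem List.reverse_ofFn_eq {α : Type*} {n : ℕ} (f : Fin n → α) :
    (List.ofFn f).reverse = List.ofFn fun i => f (Fin.revPerm i) := by
  refine List.ext_getElem (by simp) fun i h₁ h₂ => ?_
  simp only [List.getElem_reverse, List.getElem_ofFn, List.length_ofFn, Fin.revPerm_apply]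
  congr 1
  ext
  simp only [Fin.val_rev]
  lia

/-- If each factor is skew-adjoint for the bilinear form with matrix `C`, then the adjoint of a
product is, up to sign, the product in reverse order. -/
theorem Matrix.transpose_list_prod_mul_of_skewAdjoint {n R : Type*} [Fintype n] [DecidableEq n]
    [CommRing R] {C : Matrix n n R} (l : List (Matrix n n R))
    (h : ∀ B ∈ l, Bᵀ * C = -(C * B)) :
    l.prodᵀ * C = (-1 : R) ^ l.length • (C * l.reverse.prod) := by
  induction l with
  | nil => simp
  | cons B l ih =>
    have hB := h B (by simp)
    have hl := ih fun D hD => h D (by simp [hD])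
    rw [List.prod_cons, transpose_mul, Matrix.mul_assoc, hB, Matrix.mul_neg, ← Matrix.mul_assoc, hl]
    simp [pow_succ, Matrix.mul_assoc]

section Majorana

variable {Γ : Fin 11 → Matrix (Fin 32) (Fin 32) ℝ}

theorem CliffordRel.zero_mul_zero (h : CliffordRel Γ) : Γ 0 * Γ 0 = -1 := by
  have h₀ := h 0 0
  rw [← two_smul ℝ, mul_smul] at h₀
  simpa [eta] using smul_right_injective _ (two_ne_zero' ℝ) h₀

theorem Majorana.transpose_zero (hM : Majorana Γ) : (Γ 0)ᵀ = -Γ 0 := by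
  rw [hM.2.2, hM.1.zero_mul_zero, neg_one_mul]

theorem Majorana.transpose_mul_zero (hM : Majorana Γ) (a : Fin 11) :
    (Γ a)ᵀ * Γ 0 = -(Γ 0 * Γ a) := by
  rw [hM.2.2, Matrix.mul_assoc, hM.1.zero_mul_zero, mul_neg_one]

theorem Majorana.transpose_gammaA_mul_zero (hM : Majorana Γ) (p : ℕ) (a : Fin p → Fin 11) :
    (gammaA Γ p a)ᵀ * Γ 0 = (-1 : ℝ) ^ (p * (p + 1) / 2) • (Γ 0 * gammaA Γ p a) := by
  have hprod (σ : Equiv.Perm (Fin p)) : (List.ofFn fun i => Γ (a (σ i))).prodᵀ * Γ 0 =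
      (-1 : ℝ) ^ p • (Γ 0 * (List.ofFn fun i => Γ (a ((σ * Fin.revPerm : Equiv.Perm (Fin p)) i))).prod) := by
    rw [transpose_list_prod_mul_of_skewAdjoint, List.length_ofFn, List.reverse_ofFn_eq]
    · rfl
    · intro B hB
      obtain ⟨i, rfl⟩ := (List.mem_ofFn' _ _).1 hB
      exact hM.transpose_mul_zero _
  have hexp : p * (p + 1) / 2 = p * (p - 1) / 2 + p := by
    rw [← Finset.sum_range_id, ← Finset.sum_range_succ, Finset.sum_range_id, mul_comm,
      Nat.add_sub_cancel]
  have hsign (σ : Equiv.Perm (Fin p)) : ((Equiv.Perm.sign σ : ℤ) : ℝ) * (-1) ^ p =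
      (-1) ^ (p * (p + 1) / 2) * ((Equiv.Perm.sign (σ * Fin.revPerm) : ℤ) : ℝ) := by
    rw [Equiv.Perm.sign_mul, Equiv.Perm.sign_revPerm, hexp, pow_add]
    push_cast
    have hsq : (-1 : ℝ) ^ (p * (p - 1) / 2) * (-1) ^ (p * (p - 1) / 2) = 1 := by
      rw [← mul_pow]; simp
    linear_combination -((Equiv.Perm.sign σ : ℤ) : ℝ) * (-1) ^ p * hsq
  simp only [gammaA, transpose_smul, transpose_sum, Matrix.smul_mul, Matrix.mul_smul,
    Finset.sum_mul, Finset.mul_sum, hprod, smul_smul, hsign]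
  simp only [mul_smul, ← Finset.smul_sum]
  rw [smul_comm]
  congr 2
  exact Equiv.sum_comp (Equiv.mulRight Fin.revPerm) fun τ : Equiv.Perm (Fin p) =>
    ((Equiv.Perm.sign τ : ℤ) : ℝ) • (Γ 0 * (List.ofFn fun i => Γ (a (τ i))).prod)

end Majorana

/-- Graded skew-symmetry of the Majorana pairing:
`(ψ̄ Γ_{a₁⋯a_p} φ) = −(−1)^{p(p+1)/2} (φ̄ Γ_{a₁⋯a_p} ψ)` for all `0 ≤ p ≤ 11`;
in particular for `p = 0` the pairing is skew-symmetric. -/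
theorem pair_gammaA_symm (Γ : Fin 11 → Matrix (Fin 32) (Fin 32) ℝ) (hM : Majorana Γ)
    (p : ℕ) (hp : p ≤ 11) (a : Fin p → Fin 11) (ψ φ : Fin 32 → ℝ) :
    pair Γ (gammaA Γ p a) ψ φ
      = -(-1 : ℝ) ^ (p * (p + 1) / 2) * pair Γ (gammaA Γ p a) φ ψ := by
  have h : (Γ 0 * gammaA Γ p a)ᵀ = -(-1 : ℝ) ^ (p * (p + 1) / 2) • (Γ 0 * gammaA Γ p a) := by
    rw [transpose_mul, hM.transpose_zero, Matrix.mul_neg, hM.transpose_gammaA_mul_zero, neg_smul]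
  unfold pair
  rw [dotProduct_mulVec, ← mulVec_transpose, h, smul_mulVec, smul_dotProduct, smul_eq_mul,
    dotProduct_comm]

end
end

section
/- Let (Γ_a)_{a=0}^{10} be a Majorana representation. Then for all ψ, φ₁, φ₂ ∈ ℝ³² the Fierz decomposition holds: (φ̄₁ ψ)(ψ̄ φ₂) = (1/32) [ Σ_{a} (ψ̄ Γ^a ψ)(φ̄₁ Γ_a φ₂) − (1/2) Σ_{a₁,a₂} (ψ̄ Γ^{a₁a₂} ψ)(φ̄₁ Γ_{a₁a₂} φ₂) + (1/5!) Σ_{a₁,…,a₅} (ψ̄ Γ^{a₁⋯a₅} ψ)(φ̄₁ Γ_{a₁⋯a₅} φ₂) ], where all index sums run over {0,…,10}. -/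
open Matrix BigOperators

noncomputable section

/-- The index-raised antisymmetrized Clifford element
`Γ^{a₁⋯a_p} = Σ_b η^{a₁b₁} ⋯ η^{a_pb_p} Γ_{b₁⋯b_p}`. -/
def gammaU {A : Type*} [Ring A] [Algebra ℝ A] (Γ : Fin 11 → A) (p : ℕ)
    (a : Fin p → Fin 11) : A :=
  ∑ b : Fin p → Fin 11, (∏ i, eta (a i) (b i)) • gammaA Γ p b

/-- The ordered product of the `Γ_x`, `x` running through the list `l`. -/
def gammaL {A : Type*} [Ring A] (Γ : Fin 11 → A) (l : List (Fin 11)) : A :=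
  (l.map Γ).prod

section Clifford

variable {A : Type*} [Ring A] {Γ : Fin 11 → A}

theorem gammaL_nil : gammaL Γ [] = 1 := rfl

theorem gammaL_cons (x : Fin 11) (l : List (Fin 11)) :
    gammaL Γ (x :: l) = Γ x * gammaL Γ l := by
  simp [gammaL]

theorem gammaL_append (l l' : List (Fin 11)) :
    gammaL Γ (l ++ l') = gammaL Γ l * gammaL Γ l' := by
  simp [gammaL]

theorem prod_ofFn_comp_adjacent_swap {n : ℕ} (v : Fin (n + 1) → A)
    (hv : Pairwise fun i j => v i * v j = -(v j * v i)) (i : Fin n) :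
    (List.ofFn (v ∘ Equiv.swap i.castSucc i.succ)).prod = -(List.ofFn v).prod := by
  induction n with
  | zero => exact i.elim0
  | succ n ih =>
    cases i using Fin.cases with
    | zero =>
      have h₂ : ∀ k : Fin n, Equiv.swap (0 : Fin (n + 2)) 1 k.succ.succ = k.succ.succ :=
        fun k => Equiv.swap_apply_of_ne_of_ne (Fin.succ_ne_zero _)
          (fun h => Fin.succ_ne_zero k (Fin.succ_injective _ h))
      have h₃ : Equiv.swap (0 : Fin (n + 2)) 1 0 = 1 := Equiv.swap_apply_left _ _
      have h₄ : Equiv.swap (0 : Fin (n + 2)) 1 1 = 0 := Equiv.swap_apply_right _ _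
      simp only [List.ofFn_succ, List.prod_cons, Function.comp_apply, Fin.castSucc_zero,
        Fin.succ_zero_eq_one, h₂, h₃, h₄, ← mul_assoc]
      rw [hv (show (1 : Fin (n + 2)) ≠ 0 by simp), neg_mul]
    | succ j =>
      have h₀ : Equiv.swap j.succ.castSucc j.succ.succ 0 = 0 :=
        Equiv.swap_apply_of_ne_of_ne (by simp [Fin.ext_iff]) (by simp [Fin.ext_iff])
      have h₁ : ∀ k : Fin (n + 1), Equiv.swap j.succ.castSucc j.succ.succ k.succ
          = (Equiv.swap j.castSucc j.succ k).succ := fun k => by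
        rw [Fin.castSucc_succ, (Fin.succ_injective _).swap_apply]
      have := ih (v ∘ Fin.succ) (fun a b hab => hv ((Fin.succ_injective _).ne hab)) j
      rw [List.ofFn_succ, List.ofFn_succ (f := v), List.prod_cons, List.prod_cons, ← mul_neg]
      simp only [Function.comp_def] at this ⊢
      simp only [h₀, h₁, this]

variable [Algebra ℝ A]

theorem CliffordRel.anticomm_s11 (h : CliffordRel Γ) {a b : Fin 11} (hab : a ≠ b) :
    Γ a * Γ b = -(Γ b * Γ a) := by
  have := h a b
  simp only [eta, if_neg hab, mul_zero, zero_smul] at this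
  exact eq_neg_of_add_eq_zero_left this

theorem CliffordRel.sq (h : CliffordRel Γ) (a : Fin 11) :
    Γ a * Γ a = eta a a • (1 : A) := by
  have := h a a
  rw [← two_smul ℝ, mul_smul] at this
  exact (smul_right_injective A (two_ne_zero' ℝ)) this

theorem eta_self_mul_self (a : Fin 11) : eta a a * eta a a = 1 := by
  by_cases h : a = 0 <;> simp [eta, h]

/-- Reordering the factors changes the product at most by a sign. -/
theorem CliffordRel.gammaL_perm (h : CliffordRel Γ) {l l' : List (Fin 11)} (hl : l.Perm l') :
    gammaL Γ l = gammaL Γ l' ∨ gammaL Γ l = -gammaL Γ l' := by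
  induction hl with
  | nil => exact Or.inl rfl
  | cons x _ ih =>
    rcases ih with ih | ih <;> simp [gammaL_cons, ih]
  | swap x y l =>
    by_cases hxy : y = x
    · subst hxy; exact Or.inl rfl
    · right
      simp only [gammaL_cons, ← mul_assoc]
      rw [h.anticomm_s11 hxy, neg_mul]
  | trans _ _ ih₁ ih₂ =>
    rcases ih₁ with ih₁ | ih₁ <;> rcases ih₂ with ih₂ | ih₂ <;> simp [ih₁, ih₂]

theorem CliffordRel.gammaL_mul_of_notMem (h : CliffordRel Γ) {x : Fin 11} {l : List (Fin 11)}
    (hx : x ∉ l) : gammaL Γ l * Γ x = (-1 : ℝ) ^ l.length • (Γ x * gammaL Γ l) := by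
  induction l with
  | nil => simp [gammaL_nil]
  | cons y l ih =>
    rw [List.mem_cons, not_or] at hx
    rw [gammaL_cons, mul_assoc, ih hx.2, mul_smul_comm, ← mul_assoc,
      h.anticomm_s11 (Ne.symm hx.1), List.length_cons, pow_succ]
    simp [mul_assoc]

theorem CliffordRel.gammaL_mul (h : CliffordRel Γ) (x : Fin 11) {l : List (Fin 11)}
    (hl : l.Nodup) :
    gammaL Γ l * Γ x =
      ((-1 : ℝ) ^ l.length * if x ∈ l then -1 else 1) • (Γ x * gammaL Γ l) := by
  by_cases hx : x ∈ l
  · induction l with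
    | nil => simp at hx
    | cons y l ih =>
      rw [List.nodup_cons] at hl
      by_cases hxy : x = y
      · subst hxy
        rw [gammaL_cons, mul_assoc, h.gammaL_mul_of_notMem hl.1]
        simp [pow_succ]
      · have hxl : x ∈ l := by simpa [hxy] using hx
        rw [gammaL_cons, mul_assoc, ih hl.2 hxl, mul_smul_comm, ← mul_assoc,
          h.anticomm_s11 (Ne.symm hxy), if_pos hx, if_pos hxl, List.length_cons, pow_succ, mul_assoc]
        simp [mul_assoc]
  · simp [h.gammaL_mul_of_notMem hx, hx]

theorem CliffordRel.gammaL_mul_reverse (h : CliffordRel Γ) (l : List (Fin 11)) :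
    gammaL Γ l * gammaL Γ l.reverse = (l.map fun x => eta x x).prod • (1 : A) := by
  induction l with
  | nil => simp [gammaL_nil]
  | cons x l ih =>
    rw [List.reverse_cons, gammaL_append, gammaL_cons, gammaL_cons, gammaL_nil, mul_one,
      mul_assoc, ← mul_assoc (gammaL Γ l), ih]
    simp [h.sq, smul_smul, mul_comm]

theorem CliffordRel.gammaL_reverse (h : CliffordRel Γ) {l : List (Fin 11)} (hl : l.Nodup) :
    gammaL Γ l.reverse = (-1 : ℝ) ^ l.length.choose 2 • gammaL Γ l := by
  induction l with
  | nil => simp [gammaL_nil]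
  | cons x l ih =>
    rw [List.nodup_cons] at hl
    rw [List.reverse_cons, gammaL_append, gammaL_cons, gammaL_cons, gammaL_nil, mul_one,
      ih hl.2, smul_mul_assoc, h.gammaL_mul_of_notMem hl.1, smul_smul, ← pow_add,
      List.length_cons, Nat.choose_succ_succ', Nat.choose_one_right, add_comm]

theorem CliffordRel.gammaL_sq (h : CliffordRel Γ) {l : List (Fin 11)} (hl : l.Nodup) :
    gammaL Γ l * gammaL Γ l =
      ((-1 : ℝ) ^ l.length.choose 2 * (l.map fun x => eta x x).prod) • (1 : A) := by
  have h₁ := h.gammaL_mul_reverse l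
  rw [h.gammaL_reverse hl, mul_smul_comm] at h₁
  rw [mul_smul, ← h₁, smul_smul, ← mul_pow]
  simp

theorem prod_ofFn_comp_perm {n : ℕ} (σ : Equiv.Perm (Fin n)) (v : Fin n → A)
    (hv : Pairwise fun i j => v i * v j = -(v j * v i)) :
    (List.ofFn (v ∘ σ)).prod = ((Equiv.Perm.sign σ : ℤ) : ℝ) • (List.ofFn v).prod := by
  cases n with
  | zero => simp [Subsingleton.elim σ 1]
  | succ n =>
    have hσ : σ ∈ Submonoid.closure
        (Set.range fun i : Fin n => Equiv.swap i.castSucc i.succ) := by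
      rw [Equiv.Perm.mclosure_swap_castSucc_succ]; trivial
    induction hσ using Submonoid.closure_induction generalizing v with
    | mem x hx =>
      obtain ⟨i, rfl⟩ := hx
      rw [prod_ofFn_comp_adjacent_swap v hv i,
        Equiv.Perm.sign_swap (Fin.castSucc_lt_succ).ne]
      simp
    | one => simp
    | mul x y _ _ hx hy =>
      rw [Equiv.Perm.coe_mul, ← Function.comp_assoc,
        hy (v ∘ x) (fun a b hab => hv (x.injective.ne hab)), hx v hv, smul_smul]
      simp [mul_comm]

theorem CliffordRel.gammaA_of_injective (h : CliffordRel Γ) {p : ℕ} {a : Fin p → Fin 11}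
    (ha : Function.Injective a) : gammaA Γ p a = gammaL Γ (List.ofFn a) := by
  have key : ∀ σ : Equiv.Perm (Fin p),
      ((Equiv.Perm.sign σ : ℤ) : ℝ) • (List.ofFn fun i => Γ (a (σ i))).prod
        = gammaL Γ (List.ofFn a) := fun σ => by
    have := prod_ofFn_comp_perm σ (Γ ∘ a) (fun i j hij => h.anticomm_s11 (ha.ne hij))
    simp only [Function.comp_def] at this
    rw [this, smul_smul, gammaL, List.map_ofFn, ← Int.cast_mul, Int.units_coe_mul_self]
    simp [Function.comp_def]
  have hp : (p.factorial : ℝ) ≠ 0 := by exact_mod_cast p.factorial_ne_zero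
  rw [gammaA, Finset.sum_congr rfl fun σ _ => key σ, Finset.sum_const, Finset.card_univ,
    Fintype.card_perm, Fintype.card_fin, ← Nat.cast_smul_eq_nsmul ℝ, smul_smul,
    inv_mul_cancel₀ hp, one_smul]

theorem gammaA_of_not_injective {p : ℕ} {a : Fin p → Fin 11}
    (ha : ¬ Function.Injective a) : gammaA Γ p a = 0 := by
  obtain ⟨i, j, hij, hne⟩ : ∃ i j, a i = a j ∧ i ≠ j := by
    simpa [Function.Injective] using ha
  have hs : ∀ k, a (Equiv.swap i j k) = a k := fun k => by
    rw [Equiv.swap_apply_def]; split_ifs <;> simp_all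
  rw [gammaA]
  set f : Equiv.Perm (Fin p) → A := fun σ =>
    ((Equiv.Perm.sign σ : ℤ) : ℝ) • (List.ofFn fun i => Γ (a (σ i))).prod with hf
  have hneg : ∀ σ, f (Equiv.swap i j * σ) = -f σ := fun σ => by
    simp [hf, hs, Equiv.Perm.sign_swap hne]
  have hsum : ∑ σ, f σ = -∑ σ, f σ := by
    rw [← Finset.sum_neg_distrib, ← Equiv.sum_comp (Equiv.mulLeft (Equiv.swap i j))]
    exact Finset.sum_congr rfl fun σ _ => hneg σ
  have : (2 : ℝ) • ∑ σ, f σ = 0 := by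
    rw [two_smul]; nth_rewrite 1 [hsum]; exact neg_add_cancel _
  rw [(smul_eq_zero_iff_right (two_ne_zero' ℝ)).1 this, smul_zero]

theorem gammaU_eq {p : ℕ} (a : Fin p → Fin 11) :
    gammaU Γ p a = (∏ i, eta (a i) (a i)) • gammaA Γ p a := by
  rw [gammaU]
  refine Finset.sum_eq_single a (fun b _ hb => ?_) (by simp)
  obtain ⟨i, hi⟩ := Function.ne_iff.1 hb
  rw [Finset.prod_eq_zero (Finset.mem_univ i), zero_smul]
  simp [eta, Ne.symm hi]

end Clifford

/-- A sum over injective tuples of a function of the underlying set is `p!` times the sum over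
the `p`-element sets. -/
theorem sum_tuples_eq_factorial_mul_sum_powersetCard {α : Type*} [Fintype α] [DecidableEq α]
    {p : ℕ} (f : (Fin p → α) → ℝ) (F : Finset α → ℝ)
    (h₀ : ∀ a, ¬ Function.Injective a → f a = 0)
    (h₁ : ∀ a, Function.Injective a → f a = F (Finset.univ.image a)) :
    ∑ a, f a = (p.factorial : ℝ) * ∑ S ∈ Finset.powersetCard p Finset.univ, F S := by
  classical
  rw [← Finset.sum_filter_of_ne (p := Function.Injective)
    (fun a _ ha => by_contra fun hi => ha (h₀ a hi)),
    ← Finset.sum_fiberwise_of_maps_to (t := Finset.powersetCard p Finset.univ)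
      (g := fun a => Finset.univ.image a), Finset.mul_sum]
  · refine Finset.sum_congr rfl fun S hS => ?_
    have hcard : S.card = p := (Finset.mem_powersetCard.1 hS).2
    rw [Finset.sum_congr rfl (g := fun _ => F S), Finset.sum_const, nsmul_eq_mul]
    · congr 2
      have e : Fin p ≃ S := (S.equivFinOfCardEq hcard).symm
      have := Fintype.card_perm (α := Fin p)
      rw [Fintype.card_fin] at this
      rw [← this, ← Finset.card_univ]
      symm
      refine Finset.card_bij (fun σ _ => fun i => (e (σ i) : α)) ?_ ?_ ?_
      · intro σ _
        simp only [Finset.mem_filter, Finset.mem_univ, true_and]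
        refine ⟨fun i j hij => σ.injective (e.injective (Subtype.ext hij)), ?_⟩
        ext x
        simp only [Finset.mem_image, Finset.mem_univ, true_and]
        constructor
        · rintro ⟨i, rfl⟩; exact (e (σ i)).2
        · intro hx; exact ⟨σ.symm (e.symm ⟨x, hx⟩), by simp⟩
      · intro σ _ τ _ hστ
        ext i
        exact congrArg Fin.val (e.injective (Subtype.ext (congrFun hστ i)))
      · intro a ha
        simp only [Finset.mem_filter, Finset.mem_univ, true_and] at ha
        have hmem : ∀ i, a i ∈ S := fun i => by rw [← ha.2]; simp
        have hinj : Function.Injective fun i => e.symm ⟨a i, hmem i⟩ := fun i j hij =>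
          ha.1 (congrArg Subtype.val (e.symm.injective hij))
        exact ⟨Equiv.ofBijective _ (Finite.injective_iff_bijective.1 hinj), Finset.mem_univ _,
          by funext i; simp⟩
    · intro a ha
      simp only [Finset.mem_filter, Finset.mem_univ, true_and] at ha
      rw [h₁ a ha.1, ha.2]
  · intro a ha
    simp only [Finset.mem_filter, Finset.mem_univ, true_and] at ha
    simp [Finset.mem_powersetCard, Finset.card_image_of_injective _ ha]

/-- A trace-orthogonal family of `n²` matrices of size `n` is a basis, with the evident
coefficients. -/
theorem eq_sum_trace_smul_of_orthogonal {ι n : Type*} [Fintype ι] [DecidableEq ι] [Fintype n]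
    [DecidableEq n] (B : ι → Matrix n n ℝ) (d : ι → ℝ) (hd : ∀ i, d i ≠ 0)
    (hcard : Fintype.card ι = Fintype.card n * Fintype.card n)
    (hB : ∀ i j, (B i * B j).trace = if i = j then d i else 0) (M : Matrix n n ℝ) :
    M = ∑ i, ((d i)⁻¹ * (M * B i).trace) • B i := by
  have coeff : ∀ (c : ι → ℝ) (j : ι), ((∑ i, c i • B i) * B j).trace = c j * d j := by
    intro c j
    simp [Finset.sum_mul, Matrix.trace_sum, Matrix.trace_smul, hB]
  have hli : LinearIndependent ℝ B := by
    rw [Fintype.linearIndependent_iff]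
    intro c hc j
    have := coeff c j
    rw [hc, zero_mul, Matrix.trace_zero] at this
    exact (mul_eq_zero.1 this.symm).resolve_right (hd j)
  have hspan : Submodule.span ℝ (Set.range B) = ⊤ :=
    hli.span_eq_top_of_card_eq_finrank' (by simp [Module.finrank_matrix, hcard])
  obtain ⟨c, hc⟩ := (Submodule.mem_span_range_iff_exists_fun ℝ).1
    (hspan ▸ Submodule.mem_top : M ∈ Submodule.span ℝ (Set.range B))
  subst hc
  refine Finset.sum_congr rfl fun j _ => ?_
  rw [coeff, mul_comm (c j), inv_mul_cancel_left₀ (hd j)]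

section Majorana

variable {Γ : Fin 11 → Matrix (Fin 32) (Fin 32) ℝ}

theorem pair_smul (c : ℝ) (M : Matrix (Fin 32) (Fin 32) ℝ) (ψ φ : Fin 32 → ℝ) :
    pair Γ (c • M) ψ φ = c * pair Γ M ψ φ := by
  simp [pair, Matrix.smul_mulVec]

theorem pair_neg (M : Matrix (Fin 32) (Fin 32) ℝ) (ψ φ : Fin 32 → ℝ) :
    pair Γ (-M) ψ φ = -pair Γ M ψ φ := by
  simp [pair, Matrix.neg_mulVec]

theorem pair_zero (ψ φ : Fin 32 → ℝ) : pair Γ 0 ψ φ = 0 := by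
  simp [pair]

theorem pair_sum {ι : Type*} (s : Finset ι) (M : ι → Matrix (Fin 32) (Fin 32) ℝ)
    (ψ φ : Fin 32 → ℝ) : pair Γ (∑ i ∈ s, M i) ψ φ = ∑ i ∈ s, pair Γ (M i) ψ φ := by
  simp [pair, Finset.mul_sum, Matrix.sum_mulVec, dotProduct_sum]

theorem CliffordRel.trace_eq_zero (h : CliffordRel Γ) (x : Fin 11)
    {M : Matrix (Fin 32) (Fin 32) ℝ} (hM : M * Γ x = -(Γ x * M)) : M.trace = 0 := by
  have h₁ : (M * Γ x * Γ x).trace = eta x x * M.trace := by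
    rw [mul_assoc, h.sq]; simp
  have h₂ : (M * Γ x * Γ x).trace = -(M * Γ x * Γ x).trace := by
    nth_rewrite 1 [hM]
    rw [neg_mul, Matrix.trace_neg, mul_assoc (Γ x), Matrix.trace_mul_comm (Γ x)]
  have h₃ : eta x x * M.trace = 0 := by linarith
  have h₄ : eta x x ≠ 0 := left_ne_zero_of_mul_eq_one (eta_self_mul_self x)
  exact (mul_eq_zero.1 h₃).resolve_left h₄

/-- The square of `Γ_S` for a set `S` of indices. -/
def gammaSign (S : Finset (Fin 11)) : ℝ :=
  (-1) ^ S.card.choose 2 * ∏ x ∈ S, eta x x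

theorem gammaSign_mul_self (S : Finset (Fin 11)) : gammaSign S * gammaSign S = 1 := by
  rw [gammaSign, mul_mul_mul_comm, ← mul_pow, ← Finset.prod_mul_distrib]
  simp [eta_self_mul_self]

theorem CliffordRel.trace_gammaL_mul_gammaL (h : CliffordRel Γ) {S T : Finset (Fin 11)}
    (hS : S.card ≤ 5) (hT : T.card ≤ 5) :
    (gammaL Γ S.toList * gammaL Γ T.toList).trace = if S = T then 32 * gammaSign S else 0 := by
  split_ifs with hST
  · subst hST
    rw [h.gammaL_sq S.nodup_toList, Matrix.trace_smul, Matrix.trace_one, Finset.length_toList,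
      Finset.prod_map_toList, gammaSign, Fintype.card_fin, smul_eq_mul, mul_comm]
    norm_num
  · have key : ∀ x, gammaL Γ S.toList * gammaL Γ T.toList * Γ x =
        (((-1 : ℝ) ^ S.card * if x ∈ S then -1 else 1) *
          ((-1 : ℝ) ^ T.card * if x ∈ T then -1 else 1)) •
          (Γ x * (gammaL Γ S.toList * gammaL Γ T.toList)) := fun x => by
      rw [mul_assoc, h.gammaL_mul x T.nodup_toList, mul_smul_comm, ← mul_assoc,
        h.gammaL_mul x S.nodup_toList, smul_mul_assoc, smul_smul, mul_assoc (Γ x)]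
      simp only [Finset.mem_toList, Finset.length_toList]
      rw [mul_comm (_ * _ : ℝ)]
    suffices hx : ∃ x, (((-1 : ℝ) ^ S.card * if x ∈ S then -1 else 1) *
          ((-1 : ℝ) ^ T.card * if x ∈ T then -1 else 1)) = -1 by
      obtain ⟨x, hx⟩ := hx
      exact h.trace_eq_zero x (by rw [key x, hx, neg_one_smul])
    have hdiff : ∃ x, ¬(x ∈ S ↔ x ∈ T) := by
      by_contra! hc
      exact hST (Finset.ext hc)
    have hsame : ∃ x, (x ∈ S ↔ x ∈ T) := by
      by_contra! hc
      have hu : (Finset.univ : Finset (Fin 11)) ⊆ S ∪ T := fun x _ => by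
        have := hc x
        rw [Finset.mem_union]
        tauto
      have h₁ := Finset.card_le_card hu
      have h₂ := Finset.card_union_le S T
      rw [Finset.card_univ, Fintype.card_fin] at h₁
      omega
    rcases Nat.even_or_odd S.card with hs | hs <;> rcases Nat.even_or_odd T.card with ht | ht
    · obtain ⟨x, hx⟩ := hdiff
      refine ⟨x, ?_⟩
      by_cases h₁ : x ∈ S <;> by_cases h₂ : x ∈ T <;> simp_all
    · obtain ⟨x, hx⟩ := hsame
      refine ⟨x, ?_⟩
      by_cases h₁ : x ∈ S <;> by_cases h₂ : x ∈ T <;> simp_all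
    · obtain ⟨x, hx⟩ := hsame
      refine ⟨x, ?_⟩
      by_cases h₁ : x ∈ S <;> by_cases h₂ : x ∈ T <;> simp_all
    · obtain ⟨x, hx⟩ := hdiff
      refine ⟨x, ?_⟩
      by_cases h₁ : x ∈ S <;> by_cases h₂ : x ∈ T <;> simp_all

theorem Majorana.transpose_gammaL (hM : Majorana Γ) (l : List (Fin 11)) :
    (gammaL Γ l)ᵀ = (-(-1 : ℝ) ^ l.length) • (Γ 0 * gammaL Γ l.reverse * Γ 0) := by
  have h₀ : Γ 0 * Γ 0 = -1 := by rw [hM.1.sq]; simp [eta]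
  induction l with
  | nil => simp [gammaL_nil, h₀]
  | cons x l ih =>
    rw [gammaL_cons, Matrix.transpose_mul, ih, hM.2.2, List.reverse_cons, gammaL_append,
      gammaL_cons, gammaL_nil, mul_one, smul_mul_assoc]
    have : Γ 0 * gammaL Γ l.reverse * Γ 0 * (Γ 0 * Γ x * Γ 0)
        = Γ 0 * gammaL Γ l.reverse * (Γ 0 * Γ 0) * Γ x * Γ 0 := by
      simp only [mul_assoc]
    rw [this, h₀]
    simp [pow_succ, mul_assoc]

theorem Majorana.transpose_mul_gammaL (hM : Majorana Γ) {l : List (Fin 11)} (hl : l.Nodup) :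
    (Γ 0 * gammaL Γ l)ᵀ
      = (-(-1 : ℝ) ^ (l.length + l.length.choose 2)) • (Γ 0 * gammaL Γ l) := by
  have h₀ : Γ 0 * Γ 0 = -1 := by rw [hM.1.sq]; simp [eta]
  have ht : (Γ 0)ᵀ = -Γ 0 := by rw [hM.2.2, h₀, neg_one_mul]
  rw [Matrix.transpose_mul, hM.transpose_gammaL, ht, smul_mul_assoc, mul_neg, mul_assoc _ (Γ 0),
    h₀, hM.1.gammaL_reverse hl, pow_add]
  simp [smul_smul]

theorem Majorana.pair_gammaL_self_eq_zero (hM : Majorana Γ) {l : List (Fin 11)} (hl : l.Nodup)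
    (he : Even (l.length + l.length.choose 2)) (ψ : Fin 32 → ℝ) :
    pair Γ (gammaL Γ l) ψ ψ = 0 := by
  have ht := hM.transpose_mul_gammaL hl
  rw [he.neg_one_pow, neg_one_smul] at ht
  have : pair Γ (gammaL Γ l) ψ ψ = -pair Γ (gammaL Γ l) ψ ψ := by
    conv_lhs => rw [pair, Matrix.dotProduct_mulVec, ← Matrix.mulVec_transpose, ht,
      Matrix.neg_mulVec, neg_dotProduct, dotProduct_comm]
    rfl
  linarith

/-- The summand of the Fierz expansion belonging to a set of indices. -/
def fierzTerm (Γ : Fin 11 → Matrix (Fin 32) (Fin 32) ℝ) (ψ φ₁ φ₂ : Fin 32 → ℝ)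
    (S : Finset (Fin 11)) : ℝ :=
  (∏ x ∈ S, eta x x) *
    (pair Γ (gammaL Γ S.toList) ψ ψ * pair Γ (gammaL Γ S.toList) φ₁ φ₂)

theorem CliffordRel.sum_pair_gammaU_mul_pair_gammaA (h : CliffordRel Γ) (p : ℕ)
    (ψ φ₁ φ₂ : Fin 32 → ℝ) :
    ∑ a : Fin p → Fin 11, pair Γ (gammaU Γ p a) ψ ψ * pair Γ (gammaA Γ p a) φ₁ φ₂
      = (p.factorial : ℝ) *
        ∑ S ∈ Finset.powersetCard p Finset.univ, fierzTerm Γ ψ φ₁ φ₂ S := by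
  refine sum_tuples_eq_factorial_mul_sum_powersetCard _ _ (fun a ha => ?_) fun a ha => ?_
  · rw [gammaA_of_not_injective ha, pair_zero, mul_zero]
  · have hp : (List.ofFn a).Perm (Finset.univ.image a).toList := by
      rw [List.perm_ext_iff_of_nodup (List.nodup_ofFn.2 ha) (Finset.nodup_toList _)]
      simp [List.mem_ofFn]
    rw [gammaU_eq, pair_smul, h.gammaA_of_injective ha, fierzTerm,
      Finset.prod_image (ha.injOn)]
    rcases h.gammaL_perm hp with hq | hq <;> simp only [hq, pair_neg] <;> ring

theorem card_finset_card_le_five :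
    Fintype.card {S : Finset (Fin 11) // S.card ≤ 5} = 32 * 32 := by
  rw [Fintype.card_subtype]
  have : (Finset.univ.filter fun S : Finset (Fin 11) => S.card ≤ 5)
      = (Finset.range 6).biUnion fun k => Finset.powersetCard k Finset.univ := by
    ext S
    simp [Finset.mem_powersetCard, Nat.lt_succ_iff]
  rw [this, Finset.card_biUnion]
  · simp [Finset.sum_range_succ, Nat.choose]
  · exact fun i _ j _ hij => Finset.pairwise_disjoint_powersetCard _ hij

theorem sum_finset_card_le_five (f : Finset (Fin 11) → ℝ) :
    ∑ S : {S : Finset (Fin 11) // S.card ≤ 5}, f S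
      = ∑ k ∈ Finset.range 6, ∑ S ∈ Finset.powersetCard k Finset.univ, f S := by
  rw [← Finset.sum_biUnion fun i _ j _ hij => Finset.pairwise_disjoint_powersetCard _ hij]
  refine (Finset.sum_subtype _ (fun S => ?_) f).symm
  simp [Finset.mem_powersetCard, Nat.lt_succ_iff]

theorem CliffordRel.pair_mul_pair (h : CliffordRel Γ) (ψ φ₁ φ₂ : Fin 32 → ℝ) :
    pair Γ 1 φ₁ ψ * pair Γ 1 ψ φ₂
      = (32 : ℝ)⁻¹ * ∑ k ∈ Finset.range 6, (-1) ^ k.choose 2 *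
          ∑ S ∈ Finset.powersetCard k Finset.univ, fierzTerm Γ ψ φ₁ φ₂ S := by
  set M : Matrix (Fin 32) (Fin 32) ℝ := vecMulVec ψ (ψ ᵥ* Γ 0) with hMdef
  have hL : pair Γ 1 φ₁ ψ * pair Γ 1 ψ φ₂ = pair Γ M φ₁ φ₂ := by
    simp only [pair, hMdef, mul_one]
    rw [← Matrix.mulVec_mulVec, Matrix.vecMulVec_mulVec, ← Matrix.dotProduct_mulVec]
    simp [Matrix.mulVec_smul, mul_comm]
  have htr : ∀ X, (M * X).trace = pair Γ X ψ ψ := fun X => by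
    rw [hMdef, Matrix.vecMulVec_mul, Matrix.trace_vecMulVec, Matrix.vecMul_vecMul,
      dotProduct_comm, ← Matrix.dotProduct_mulVec, pair]
  have hM := eq_sum_trace_smul_of_orthogonal
    (fun S : {S : Finset (Fin 11) // S.card ≤ 5} => gammaL Γ S.1.toList)
    (fun S => 32 * gammaSign S.1)
    (fun S => mul_ne_zero (by norm_num)
      (left_ne_zero_of_mul_eq_one (gammaSign_mul_self S.1)))
    (by rw [card_finset_card_le_five, Fintype.card_fin])
    (fun S T => by simp only [h.trace_gammaL_mul_gammaL S.2 T.2, Subtype.ext_iff]) M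
  rw [hL, hM, pair_sum]
  have hterm : ∀ S : Finset (Fin 11),
      pair Γ (((32 * gammaSign S)⁻¹ * (M * gammaL Γ S.toList).trace) • gammaL Γ S.toList) φ₁ φ₂
        = 32⁻¹ * ((-1) ^ S.card.choose 2 * fierzTerm Γ ψ φ₁ φ₂ S) := fun S => by
    have hinv : (gammaSign S)⁻¹ = gammaSign S :=
      inv_eq_of_mul_eq_one_right (gammaSign_mul_self S)
    rw [pair_smul, htr, mul_inv, hinv, gammaSign, fierzTerm]
    ring
  rw [Finset.sum_congr rfl fun S _ => hterm S.1, ← Finset.mul_sum,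
    sum_finset_card_le_five fun S => (-1) ^ S.card.choose 2 * fierzTerm Γ ψ φ₁ φ₂ S]
  congr 1
  refine Finset.sum_congr rfl fun k _ => ?_
  rw [Finset.mul_sum]
  exact Finset.sum_congr rfl fun S hS => by rw [(Finset.mem_powersetCard.1 hS).2]

theorem Majorana.sum_fierzTerm_eq_zero (hM : Majorana Γ) {k : ℕ} (hk : Even (k + k.choose 2))
    (ψ φ₁ φ₂ : Fin 32 → ℝ) :
    ∑ S ∈ Finset.powersetCard k Finset.univ, fierzTerm Γ ψ φ₁ φ₂ S = 0 :=
  Finset.sum_eq_zero fun S hS => by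
    rw [fierzTerm, hM.pair_gammaL_self_eq_zero S.nodup_toList, zero_mul, mul_zero]
    rwa [Finset.length_toList, (Finset.mem_powersetCard.1 hS).2]

end Majorana

/-- The basic Fierz expansion:
`(φ̄₁ ψ)(ψ̄ φ₂) = (1/32)[ Σ_a (ψ̄ Γ^a ψ)(φ̄₁ Γ_a φ₂)
  − (1/2) Σ_{a₁a₂} (ψ̄ Γ^{a₁a₂} ψ)(φ̄₁ Γ_{a₁a₂} φ₂)
  + (1/5!) Σ_{a₁…a₅} (ψ̄ Γ^{a₁⋯a₅} ψ)(φ̄₁ Γ_{a₁⋯a₅} φ₂) ]`. -/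
theorem fierz_decomposition (Γ : Fin 11 → Matrix (Fin 32) (Fin 32) ℝ)
    (hM : Majorana Γ) (ψ φ₁ φ₂ : Fin 32 → ℝ) :
    pair Γ 1 φ₁ ψ * pair Γ 1 ψ φ₂
      = (32 : ℝ)⁻¹ *
        ((∑ a : Fin 11,
            pair Γ (gammaU Γ 1 ![a]) ψ ψ * pair Γ (gammaA Γ 1 ![a]) φ₁ φ₂)
          - (1 / 2) * (∑ a₁ : Fin 11, ∑ a₂ : Fin 11,
              pair Γ (gammaU Γ 2 ![a₁, a₂]) ψ ψ * pair Γ (gammaA Γ 2 ![a₁, a₂]) φ₁ φ₂)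
          + ((Nat.factorial 5 : ℝ))⁻¹ * (∑ a : Fin 5 → Fin 11,
              pair Γ (gammaU Γ 5 a) ψ ψ * pair Γ (gammaA Γ 5 a) φ₁ φ₂)) := by
  have h₁ := hM.1.sum_pair_gammaU_mul_pair_gammaA 1 ψ φ₁ φ₂
  have h₂ := hM.1.sum_pair_gammaU_mul_pair_gammaA 2 ψ φ₁ φ₂
  have h₅ := hM.1.sum_pair_gammaU_mul_pair_gammaA 5 ψ φ₁ φ₂
  have e₁ : ∀ f : (Fin 1 → Fin 11) → ℝ, ∑ a, f a = ∑ a, f ![a] := fun f =>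
    (Equiv.sum_comp (Equiv.funUnique (Fin 1) (Fin 11)).symm f).symm.trans
      (Finset.sum_congr rfl fun a _ => congrArg f (by ext i; simp))
  have e₂ : ∀ f : (Fin 2 → Fin 11) → ℝ, ∑ a, f a = ∑ a₁, ∑ a₂, f ![a₁, a₂] := fun f => by
    rw [← Equiv.sum_comp (finTwoArrowEquiv (Fin 11)).symm f, Fintype.sum_prod_type]
    rfl
  rw [e₁] at h₁
  rw [e₂] at h₂
  rw [h₁, h₂, h₅, hM.1.pair_mul_pair]
  simp only [Finset.sum_range_succ, Finset.sum_range_zero]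
  rw [hM.sum_fierzTerm_eq_zero (k := 0) (by decide), hM.sum_fierzTerm_eq_zero (k := 3) (by decide),
    hM.sum_fierzTerm_eq_zero (k := 4) (by decide)]
  norm_num [Nat.choose, Nat.factorial]
  ring

end
end
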